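/- Suppose $Q$ is a basic sequence with $q_n \to \infty$. Then the set $\mathscr{N}_k(Q)$ of $Q$-normal numbers of order $k$ has full Lebesgue measure if $Q$ is $k$-divergent, and has Lebesgue measure zero (in any bounded interval) if $Q$ is $k$-convergent. -/

import Mathlib

open scoped Classical
open Filter MeasureTheory

noncomputable section

/-- Product of the first `n` bases of a basic sequence. -/
def cantorProd (q : ℕ → ℕ) (n : ℕ) : ℝ := ∏ i ∈ Finset.range n, (q i : ℝ)

/-- `E` is the sequence of digits of the `Q`-Cantor series expansion of `x`
(the digit `E n` is the digit `E_{n+1}` of the paper, in base `q n = q_{n+1}`). -/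
def IsCantorExp (q : ℕ → ℕ) (x : ℝ) (E : ℕ → ℕ) : Prop :=
  (∀ n, E n < q n) ∧ (∀ m, ∃ n, m ≤ n ∧ E n ≠ q n - 1) ∧
  x = (⌊x⌋ : ℝ) + ∑' n, (E n : ℝ) / cantorProd q (n + 1)

/-- Number of occurrences of the block `B` of length `k` among the first `n` digits. -/
def blockCount (E : ℕ → ℕ) (k : ℕ) (B : Fin k → ℕ) (n : ℕ) : ℕ :=
  ((Finset.range (n + 1 - k)).filter (fun j => ∀ i : Fin k, E (j + i) = B i)).card

/-- `Q_n^{(k)}`. -/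
def Qnk (q : ℕ → ℕ) (k n : ℕ) : ℝ :=
  ∑ j ∈ Finset.range n, 1 / ∏ i ∈ Finset.range k, (q (j + i) : ℝ)

/-- `x` is `Q`-normal of order `k`. -/
def QNormalOrder (q : ℕ → ℕ) (k : ℕ) (x : ℝ) : Prop :=
  ∃ E, IsCantorExp q x E ∧ ∀ B : Fin k → ℕ,
    Tendsto (fun n => (blockCount E k B n : ℝ) / Qnk q k n) atTop (nhds 1)

/-- `x` is `Q`-ratio normal of order `k`. -/
def QRatioNormalOrder (q : ℕ → ℕ) (k : ℕ) (x : ℝ) : Prop :=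
  ∃ E, IsCantorExp q x E ∧ ∀ B₁ B₂ : Fin k → ℕ,
    Tendsto (fun n => (blockCount E k B₁ n : ℝ) / (blockCount E k B₂ n : ℝ))
      atTop (nhds 1)

/-- A sequence of reals is uniformly distributed mod 1. -/
def UDMod1 (u : ℕ → ℝ) : Prop :=
  ∀ a b : ℝ, 0 ≤ a → a ≤ b → b ≤ 1 →
    Tendsto
      (fun N => (((Finset.range N).filter
          (fun n => Int.fract (u n) ∈ Set.Ico a b)).card : ℝ) / N)
      atTop (nhds (b - a))

/-- `x` is `Q`-distribution normal. -/
def QDistNormal (q : ℕ → ℕ) (x : ℝ) : Prop :=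
  UDMod1 (fun n => cantorProd q n * x)

/-- The digit function. -/
def cdig (q : ℕ → ℕ) (n : ℕ) (x : ℝ) : ℕ :=
  (⌊cantorProd q (n+1) * x⌋ - q n * ⌊cantorProd q n * x⌋).toNat

lemma cantorProd_succ (q : ℕ → ℕ) (n : ℕ) : cantorProd q (n+1) = cantorProd q n * q n := by
  simp [cantorProd, Finset.prod_range_succ]

lemma cantorProd_zero (q : ℕ → ℕ) : cantorProd q 0 = 1 := by simp [cantorProd]

lemma cantorProd_pos (q : ℕ → ℕ) (hq : ∀ n, 2 ≤ q n) (n : ℕ) : 0 < cantorProd q n :=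
  Finset.prod_pos fun i _ => by have := hq i; positivity

lemma floor_step (a : ℕ) (ha : 2 ≤ a) (y : ℝ) :
    0 ≤ ⌊y * a⌋ - a * ⌊y⌋ ∧ ⌊y * a⌋ - a * ⌊y⌋ < a := by
  have hap : (0:ℝ) < a := by positivity
  have h1 := Int.floor_le y
  have h2 := Int.lt_floor_add_one y
  constructor
  · have : (a:ℤ) * ⌊y⌋ ≤ ⌊y * a⌋ := by
      rw [Int.le_floor]; push_cast; nlinarith
    linarith
  · have : ⌊y * a⌋ < a * ⌊y⌋ + a := by
      rw [Int.floor_lt]; push_cast; nlinarith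
    linarith

lemma cdig_spec (q : ℕ → ℕ) (hq : ∀ n, 2 ≤ q n) (n : ℕ) (x : ℝ) :
    ⌊cantorProd q (n+1) * x⌋ = q n * ⌊cantorProd q n * x⌋ + cdig q n x := by
  have := floor_step (q n) (hq n) (cantorProd q n * x)
  have e : cantorProd q n * x * q n = cantorProd q (n+1) * x := by rw [cantorProd_succ]; ring
  rw [e] at this
  unfold cdig
  omega

lemma cdig_lt (q : ℕ → ℕ) (hq : ∀ n, 2 ≤ q n) (n : ℕ) (x : ℝ) : cdig q n x < q n := by
  have := floor_step (q n) (hq n) (cantorProd q n * x)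
  have e : cantorProd q n * x * q n = cantorProd q (n+1) * x := by rw [cantorProd_succ]; ring
  rw [e] at this
  unfold cdig
  omega

lemma cantorProd_ge (q : ℕ → ℕ) (hq : ∀ n, 2 ≤ q n) (n : ℕ) : (2:ℝ)^n ≤ cantorProd q n := by
  induction n with
  | zero => simp [cantorProd]
  | succ n ih =>
    rw [cantorProd_succ, pow_succ]
    have : (2:ℝ) ≤ q n := by exact_mod_cast hq n
    have := (cantorProd_pos q hq n).le
    gcongr

lemma tendsto_floor_div (q : ℕ → ℕ) (hq : ∀ n, 2 ≤ q n) (x : ℝ) :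
    Tendsto (fun n => (⌊cantorProd q n * x⌋ : ℝ) / cantorProd q n) atTop (nhds x) := by
  have h0 : Tendsto (fun n => x - (1/2:ℝ)^n) atTop (nhds x) := by
    simpa using (tendsto_pow_atTop_nhds_zero_of_lt_one (r := (1/2:ℝ)) (by norm_num)
      (by norm_num)).const_sub x
  refine tendsto_of_tendsto_of_tendsto_of_le_of_le h0 tendsto_const_nhds ?_ ?_
  · intro n
    have hp := cantorProd_pos q hq n
    have hg := cantorProd_ge q hq n
    beta_reduce
    rw [le_div_iff₀ hp]
    have h2 := Int.lt_floor_add_one (cantorProd q n * x)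
    have h3 : 1 ≤ (1/2:ℝ)^n * cantorProd q n := by
      rw [one_div, inv_pow, inv_mul_eq_div, le_div_iff₀ (by positivity)]; simpa using hg
    nlinarith
  · intro n
    have hp := cantorProd_pos q hq n
    beta_reduce
    rw [div_le_iff₀ hp]
    have := Int.floor_le (cantorProd q n * x)
    linarith

lemma isCantorExp_cdig (q : ℕ → ℕ) (hq : ∀ n, 2 ≤ q n) (x : ℝ) :
    IsCantorExp q x (fun n => cdig q n x) := by
  refine ⟨fun n => cdig_lt q hq n x, ?_, ?_⟩
  · intro m
    by_contra hcon
    push Not at hcon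
    set t : ℕ → ℝ := fun n => 1 - (cantorProd q n * x - ⌊cantorProd q n * x⌋) with ht
    have ht0 : ∀ n, 0 < t n := fun n => by
      have := Int.lt_floor_add_one (cantorProd q n * x)
      simp only [t]; linarith
    have ht1 : ∀ n, t n ≤ 1 := fun n => by
      have := Int.floor_le (cantorProd q n * x)
      simp only [t]; linarith
    have hs : ∀ n, m ≤ n → t (n+1) = q n * t n := by
      intro n hn
      have h1 := cdig_spec q hq n x
      have h2 := hcon n hn
      beta_reduce at h2
      have h3 : ((cdig q n x : ℕ) : ℝ) = q n - 1 := by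
        rw [h2, Nat.cast_sub (by have := hq n; omega)]; simp
      simp only [t]
      rw [h1]
      push_cast
      rw [h3, cantorProd_succ]
      ring
    have hg : ∀ j, 2^j * t m ≤ t (m+j) := by
      intro j
      induction j with
      | zero => simp
      | succ j ih =>
        rw [← add_assoc, hs _ (by omega), pow_succ]
        have : (2:ℝ) ≤ q (m+j) := by exact_mod_cast hq (m+j)
        have := ht0 (m+j)
        nlinarith
    obtain ⟨j, hj⟩ := pow_unbounded_of_one_lt (1 / t m) (one_lt_two (α := ℝ))
    rw [div_lt_iff₀ (ht0 m)] at hj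
    linarith [hg j, ht1 (m+j)]
  · have hpart : ∀ N, ∑ n ∈ Finset.range N, (cdig q n x : ℝ) / cantorProd q (n+1)
        = (⌊cantorProd q N * x⌋ : ℝ) / cantorProd q N - ⌊x⌋ := by
      intro N
      induction N with
      | zero => simp [cantorProd]
      | succ N ih =>
        rw [Finset.sum_range_succ, ih, cdig_spec q hq N x]
        have h1 := (cantorProd_pos q hq N).ne'
        have h2 : (q N : ℝ) ≠ 0 := by have := hq N; positivity
        rw [cantorProd_succ]
        push_cast
        field_simp
        ring
    have hT : Tendsto (fun N => ∑ n ∈ Finset.range N, (cdig q n x : ℝ) / cantorProd q (n+1))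
        atTop (nhds (x - ⌊x⌋)) := by
      simp_rw [hpart]
      exact (tendsto_floor_div q hq x).sub_const _
    have hS := (hasSum_iff_tendsto_nat_of_nonneg
      (fun n => div_nonneg (Nat.cast_nonneg _) (cantorProd_pos q hq (n+1)).le) _).2 hT
    rw [hS.tsum_eq]; ring

lemma isCantorExp_unique (q : ℕ → ℕ) (hq : ∀ n, 2 ≤ q n) (x : ℝ) (E : ℕ → ℕ)
    (h : IsCantorExp q x E) (n : ℕ) : E n = cdig q n x := by
  obtain ⟨h1, h2, h3⟩ := h
  obtain ⟨C, hC0, hC⟩ : ∃ C : ℕ → ℤ, C 0 = ⌊x⌋ ∧ ∀ n, C (n+1) = q n * C n + E n :=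
    ⟨fun n => Nat.rec ⌊x⌋ (fun n c => q n * c + E n) n, rfl, fun n => rfl⟩
  have hpp := cantorProd_pos q hq
  have hq0 : ∀ n, (0:ℝ) < q n := fun n => by have := hq n; positivity
  have hpart : ∀ N, ∑ n ∈ Finset.range N, (E n : ℝ) / cantorProd q (n+1)
      = (C N : ℝ) / cantorProd q N - ⌊x⌋ := by
    intro N
    induction N with
    | zero => simp [cantorProd, hC0]
    | succ N ih =>
      rw [Finset.sum_range_succ, ih, hC]
      have h1 := (hpp N).ne'
      have h2 := (hq0 N).ne'
      rw [cantorProd_succ]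
      push_cast
      field_simp
      ring
  have hmono : Monotone (fun n => (C n : ℝ) / cantorProd q n) := by
    refine monotone_nat_of_le_succ fun n => ?_
    have h1 := hpp n
    have h2 := hq0 n
    rw [hC, cantorProd_succ, div_le_div_iff₀ h1 (by positivity)]
    push_cast
    have : (0:ℝ) ≤ E n * cantorProd q n := by positivity
    nlinarith
  have hstep : ∀ n, ((C (n+1) : ℝ)+1) / cantorProd q (n+1)
      = ((C n : ℝ)+1) / cantorProd q n - (q n - 1 - E n) / cantorProd q (n+1) := by
    intro n
    have h1 := (hpp n).ne'
    have h2 := (hq0 n).ne'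
    rw [hC, cantorProd_succ]
    push_cast
    field_simp
    ring
  have hE : ∀ n, (E n : ℝ) + 1 ≤ q n := fun n => by exact_mod_cast h1 n
  have hanti : Antitone (fun n => ((C n : ℝ)+1) / cantorProd q n) := by
    refine antitone_nat_of_succ_le fun n => ?_
    rw [hstep]
    have := div_nonneg (a := (q n - 1 - E n : ℝ)) (by linarith [hE n]) (hpp (n+1)).le
    linarith
  have hstrict : ∀ n, ∃ m, ((C m : ℝ)+1) / cantorProd q m < ((C n : ℝ)+1) / cantorProd q n := by
    intro n
    obtain ⟨m, hm, hne⟩ := h2 n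
    refine ⟨m+1, lt_of_lt_of_le ?_ (hanti hm)⟩
    beta_reduce
    rw [hstep]
    have h4 : E m + 1 < q m := by have := h1 m; omega
    have h5 : (E m : ℝ) + 1 < q m := by exact_mod_cast h4
    have := div_pos (a := (q m - 1 - E m : ℝ)) (by linarith) (hpp (m+1))
    linarith
  have hle : ∀ n m, (C n : ℝ) / cantorProd q n ≤ ((C m : ℝ)+1) / cantorProd q m := by
    intro n m
    calc (C n : ℝ) / cantorProd q n ≤ (C (max n m) : ℝ) / cantorProd q (max n m) :=
          hmono (le_max_left _ _)
      _ ≤ ((C (max n m) : ℝ)+1) / cantorProd q (max n m) := by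
          have := hpp (max n m)
          gcongr; linarith
      _ ≤ _ := hanti (le_max_right _ _)
  have hsum : Summable (fun n => (E n : ℝ) / cantorProd q (n+1)) := by
    refine summable_of_sum_range_le (c := 1)
      (fun n => div_nonneg (Nat.cast_nonneg _) (hpp (n+1)).le) (fun N => ?_)
    rw [hpart]
    have := hle N 0
    rw [hC0, cantorProd_zero] at this
    linarith
  have hT : Tendsto (fun n => (C n : ℝ) / cantorProd q n) atTop (nhds x) := by
    have := hsum.hasSum.tendsto_sum_nat.const_add (⌊x⌋ : ℝ)
    rw [← h3] at this
    refine this.congr fun N => ?_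
    rw [hpart]; ring
  have hfl : ∀ n, ⌊cantorProd q n * x⌋ = C n := by
    intro n
    rw [Int.floor_eq_iff]
    have h1 := hmono.ge_of_tendsto hT n
    obtain ⟨m, hm⟩ := hstrict n
    have h4 : x ≤ ((C m : ℝ)+1) / cantorProd q m := le_of_tendsto' hT (fun N => hle N m)
    have h5 := h4.trans_lt hm
    rw [div_le_iff₀ (hpp n)] at h1
    rw [lt_div_iff₀ (hpp n)] at h5
    constructor <;> linarith
  unfold cdig
  rw [hfl, hfl, hC]
  omega

/-- Counting prefixes with prescribed digits. -/
lemma prefix_count (q : ℕ → ℕ) (hq : ∀ n, 2 ≤ q n) (m : ℤ) (S : Finset ℕ) (g : ℕ → ℕ) (N : ℕ) :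
    ∃ F : Finset ℤ, F.card = (∏ n ∈ Finset.range N,
        if n ∈ S then (if g n < q n then 1 else 0) else q n) ∧
      ∀ x : ℝ, (⌊x⌋ = m ∧ ∀ n < N, n ∈ S → cdig q n x = g n) ↔ ⌊cantorProd q N * x⌋ ∈ F := by
  induction N with
  | zero => exact ⟨{m}, by simp, by intro x; simp [cantorProd]⟩
  | succ N ih =>
    obtain ⟨F, hF, hx⟩ := ih
    let A : Finset ℕ := if N ∈ S then (if g N < q N then {g N} else ∅) else Finset.range (q N)
    have hAq : ∀ a ∈ A, a < q N := by
      intro a ha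
      simp only [A] at ha
      split_ifs at ha with h1 h2
      · rw [Finset.mem_singleton] at ha; omega
      · simp at ha
      · simpa using ha
    have hAm : ∀ x, (N ∈ S → cdig q N x = g N) ↔ cdig q N x ∈ A := by
      intro x
      have := cdig_lt q hq N x
      simp only [A]
      split_ifs with h1 h2
      · simp [h1]
      · simp only [h1, forall_const, Finset.notMem_empty, iff_false]; omega
      · simp [h1, this]
    have hinj : ∀ (c c' : ℤ) (a a' : ℕ), a < q N → a' < q N →
        (q N : ℤ) * c + a = q N * c' + a' → c = c' ∧ a = a' := by
      intro c c' a a' ha ha' h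
      have h1 : c = c' := by
        have e1 : ((q N : ℤ) * c + a) / q N = c := by
          rw [Int.add_comm, Int.add_mul_ediv_left _ _ (by omega),
            Int.ediv_eq_zero_of_lt (by omega) (by omega)]; simp
        have e2 : ((q N : ℤ) * c' + a') / q N = c' := by
          rw [Int.add_comm, Int.add_mul_ediv_left _ _ (by omega),
            Int.ediv_eq_zero_of_lt (by omega) (by omega)]; simp
        rw [← e1, h, e2]
      subst h1
      exact ⟨rfl, by omega⟩
    refine ⟨(F ×ˢ A).image (fun p => (q N : ℤ) * p.1 + p.2), ?_, ?_⟩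
    · rw [Finset.card_image_of_injOn, Finset.card_product, hF, Finset.prod_range_succ]
      · congr 1
        simp only [A]
        split_ifs <;> simp
      · rintro ⟨c, a⟩ h1 ⟨c', a'⟩ h2 h
        simp only [Finset.coe_product, Set.mem_prod, Finset.mem_coe] at h1 h2
        obtain ⟨r, s⟩ := hinj c c' a a' (hAq _ h1.2) (hAq _ h2.2) h
        rw [r, s]
    · intro x
      have hs := cdig_spec q hq N x
      rw [hs]
      simp only [Finset.mem_image, Finset.mem_product, Prod.exists]
      constructor
      · rintro ⟨h1, h2⟩
        exact ⟨_, _, ⟨(hx x).1 ⟨h1, fun n hn => h2 n (by omega)⟩,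
          (hAm x).1 (h2 N (by omega))⟩, rfl⟩
      · rintro ⟨c, a, ⟨hc, ha⟩, h⟩
        obtain ⟨r, s⟩ := hinj _ _ _ _ (hAq _ ha) (cdig_lt q hq N x) h
        rw [r] at hc
        rw [s] at ha
        obtain ⟨h1, h2⟩ := (hx x).2 hc
        refine ⟨h1, fun n hn => ?_⟩
        rcases Nat.lt_succ_iff_lt_or_eq.1 hn with h3 | h3
        · exact h2 n h3
        · rw [h3]; exact (hAm x).2 ha

lemma volume_floor_preimage (P : ℝ) (hP : 0 < P) (F : Finset ℤ) :
    volume {x : ℝ | ⌊P * x⌋ ∈ F} = ENNReal.ofReal (F.card / P) := by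
  have h1 : {x : ℝ | ⌊P * x⌋ ∈ F} = ⋃ a ∈ F, Set.Ico ((a:ℝ)/P) ((a+1)/P) := by
    ext x
    simp only [Set.mem_ofPred_eq, Set.mem_iUnion, Set.mem_Ico, exists_prop]
    have key : ∀ a : ℤ, ⌊P * x⌋ = a ↔ ((a:ℝ)/P ≤ x ∧ x < (a+1)/P) := by
      intro a
      rw [Int.floor_eq_iff, div_le_iff₀ hP, lt_div_iff₀ hP, mul_comm P x]
    constructor
    · intro h; exact ⟨_, h, (key _).1 rfl⟩
    · rintro ⟨a, ha, h⟩; rw [(key a).2 h]; exact ha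
  rw [h1, measure_biUnion_finset]
  · simp only [Real.volume_Ico]
    have : ∀ a : ℤ, ((a:ℝ)+1)/P - a/P = 1/P := fun a => by ring
    simp_rw [this]
    rw [Finset.sum_const, nsmul_eq_mul, ← ENNReal.ofReal_natCast, ← ENNReal.ofReal_mul (by positivity)]
    congr 1; ring
  · intro a _ b _ hab
    rw [Function.onFun, Set.disjoint_left]
    rintro x ⟨h1, h2⟩ ⟨h3, h4⟩
    rw [div_le_iff₀ hP] at h1 h3
    rw [lt_div_iff₀ hP] at h2 h4
    apply hab
    have e1 : (a:ℝ) < b + 1 := by linarith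
    have e2 : (b:ℝ) < a + 1 := by linarith
    norm_cast at e1 e2
    omega
  · intro a _; exact measurableSet_Ico

lemma measurable_cdig (q : ℕ → ℕ) (n : ℕ) : Measurable (cdig q n) := by
  unfold cdig
  refine (measurable_of_countable Int.toNat).comp ?_
  refine Measurable.sub (Int.measurable_floor.comp (measurable_const_mul _)) ?_
  exact Measurable.const_mul (Int.measurable_floor.comp (measurable_const_mul _)) _

/-- unit interval measure. -/
def unitM (m : ℤ) : Measure ℝ := volume.restrict (Set.Ico (m:ℝ) (m+1))

instance (m : ℤ) : IsProbabilityMeasure (unitM m) := ⟨by simp [unitM]⟩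

lemma unitM_digits (q : ℕ → ℕ) (hq : ∀ n, 2 ≤ q n) (m : ℤ) (S : Finset ℕ) (g : ℕ → ℕ) :
    (unitM m).real {x | ∀ n ∈ S, cdig q n x = g n}
      = ∏ n ∈ S, (if g n < q n then 1 / (q n : ℝ) else 0) := by
  have hmeas : MeasurableSet {x : ℝ | ∀ n ∈ S, cdig q n x = g n} := by
    have : {x : ℝ | ∀ n ∈ S, cdig q n x = g n} = ⋂ n ∈ S, cdig q n ⁻¹' {g n} := by
      ext x; simp
    rw [this]
    exact Finset.measurableSet_biInter _ fun n _ => measurable_cdig q n (measurableSet_singleton _)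
  obtain ⟨N, hN⟩ := S.exists_nat_subset_range
  obtain ⟨F, hF, hx⟩ := prefix_count q hq m S g N
  have hset : {x : ℝ | ∀ n ∈ S, cdig q n x = g n} ∩ Set.Ico (m:ℝ) (m+1)
      = {x | ⌊cantorProd q N * x⌋ ∈ F} := by
    ext x
    rw [Set.mem_ofPred_eq, ← hx x, Int.floor_eq_iff]
    simp only [Set.mem_inter_iff, Set.mem_ofPred_eq, Set.mem_Ico]
    constructor
    · rintro ⟨h1, h2⟩; exact ⟨h2, fun n _ hn => h1 n hn⟩
    · rintro ⟨h1, h2⟩; exact ⟨fun n hn => h2 n (Finset.mem_range.1 (hN hn)) hn, h1⟩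
  rw [measureReal_def, unitM, Measure.restrict_apply hmeas, hset,
    volume_floor_preimage _ (cantorProd_pos q hq N), ENNReal.toReal_ofReal
      (div_nonneg (Nat.cast_nonneg _) (cantorProd_pos q hq N).le), hF, cantorProd]
  push_cast
  rw [← Finset.prod_div_distrib, ← Finset.prod_subset hN]
  · refine Finset.prod_congr rfl fun n hn => ?_
    rw [if_pos hn]
    split_ifs <;> simp
  · intro n _ hn
    rw [if_neg hn]
    have : (q n : ℝ) ≠ 0 := by have := hq n; positivity
    field_simp

lemma interp (S E : ℕ → ℝ) (hS : Monotone S) (hE : Monotone E) (hS0 : 0 ≤ S 0) (hE0 : E 0 = 0)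
    (hinc : ∀ n, E (n+1) ≤ E n + 1) (u : ℕ → ℕ)
    (hu1 : ∀ m : ℕ, (m:ℝ)^2 ≤ E (u m)) (hu2 : ∀ m n : ℕ, (m:ℝ)^2 ≤ E n → u m ≤ n)
    (hEt : Tendsto E atTop atTop)
    (h : Tendsto (fun m => S (u m) / E (u m)) atTop (nhds 1)) :
    Tendsto (fun n => S n / E n) atTop (nhds 1) := by
  have hu3 : ∀ m : ℕ, E (u m) ≤ (m:ℝ)^2 + 1 := by
    intro m
    rcases hn : u m with _ | n
    · rw [hE0]; positivity
    · have : ¬ ((m:ℝ)^2 ≤ E n) := fun hh => by have := hu2 m n hh; omega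
      have := hinc n
      linarith
  have hSn : ∀ n, 0 ≤ S n := fun n => hS0.trans (hS (Nat.zero_le n))
  have hEn : ∀ n, 0 ≤ E n := fun n => hE0.symm.le.trans (hE (Nat.zero_le n))
  -- ratio tends to one
  have hinv : Tendsto (fun m : ℕ => ((m:ℝ))⁻¹) atTop (nhds 0) := tendsto_inv_atTop_nhds_zero_nat
  have hA : Tendsto (fun m : ℕ => E (u m) / (m:ℝ)^2) atTop (nhds 1) := by
    have h2 : Tendsto (fun m : ℕ => 1 + ((m:ℝ))⁻¹^2) atTop (nhds 1) := by
      simpa using (hinv.pow 2).const_add 1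
    refine tendsto_of_tendsto_of_tendsto_of_le_of_le' tendsto_const_nhds h2 ?_ ?_
    · filter_upwards [eventually_gt_atTop 0] with m hm
      have : (0:ℝ) < m := by exact_mod_cast hm
      rw [le_div_iff₀ (by positivity)]; simpa using hu1 m
    · filter_upwards [eventually_gt_atTop 0] with m hm
      have : (0:ℝ) < m := by exact_mod_cast hm
      rw [div_le_iff₀ (by positivity)]
      refine (hu3 m).trans (le_of_eq ?_)
      field_simp
  have hB : Tendsto (fun m : ℕ => S (u m) / (m:ℝ)^2) atTop (nhds 1) := by
    have := h.mul hA
    rw [one_mul] at this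
    refine this.congr' ?_
    filter_upwards [eventually_gt_atTop 0] with m hm
    have h1 : (0:ℝ) < m := by exact_mod_cast hm
    have h2 : 0 < E (u m) := lt_of_lt_of_le (by positivity) (hu1 m)
    field_simp
  have hR : Tendsto (fun m : ℕ => ((m+1:ℕ):ℝ)^2 / (m:ℝ)^2) atTop (nhds 1) := by
    have h2 : Tendsto (fun m : ℕ => (1 + ((m:ℝ))⁻¹)^2) atTop (nhds 1) := by
      simpa using (hinv.const_add 1).pow 2
    refine h2.congr' ?_
    filter_upwards [eventually_gt_atTop 0] with m hm
    have h1 : (0:ℝ) < m := by exact_mod_cast hm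
    push_cast
    field_simp
  have hup : Tendsto (fun m : ℕ => S (u (m+1)) / (m:ℝ)^2) atTop (nhds 1) := by
    have := (hB.comp (tendsto_add_atTop_nat 1)).mul hR
    rw [one_mul] at this
    refine this.congr' ?_
    filter_upwards [eventually_gt_atTop 0] with m hm
    have h1 : (0:ℝ) < m := by exact_mod_cast hm
    have h2 : (0:ℝ) < (m+1:ℕ) := by positivity
    simp only [Function.comp]
    field_simp
  have hlo : Tendsto (fun m : ℕ => S (u m) / ((m+1:ℕ):ℝ)^2) atTop (nhds 1) := by
    have := hB.mul (hR.inv₀ one_ne_zero)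
    rw [inv_one, one_mul] at this
    refine this.congr' ?_
    filter_upwards [eventually_gt_atTop 0] with m hm
    have h1 : (0:ℝ) < m := by exact_mod_cast hm
    have h2 : (0:ℝ) < (m+1:ℕ) := by positivity
    field_simp
  have hM : Tendsto (fun n => ⌊√(E n)⌋₊) atTop atTop :=
    tendsto_nat_floor_atTop.comp (Real.tendsto_sqrt_atTop.comp hEt)
  have hm1 : ∀ n, ((⌊√(E n)⌋₊ : ℕ) : ℝ)^2 ≤ E n := by
    intro n
    have := Nat.floor_le (Real.sqrt_nonneg (E n))
    calc _ ≤ √(E n)^2 := by gcongr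
      _ = _ := Real.sq_sqrt (hEn n)
  have hm2 : ∀ n, E n < ((⌊√(E n)⌋₊ + 1 : ℕ) : ℝ)^2 := by
    intro n
    have := Nat.lt_floor_add_one (√(E n))
    calc E n = √(E n)^2 := (Real.sq_sqrt (hEn n)).symm
      _ < _ := by push_cast; gcongr
  refine tendsto_of_tendsto_of_tendsto_of_le_of_le' (hlo.comp hM) (hup.comp hM) ?_ ?_
  · filter_upwards [hEt.eventually_gt_atTop 0] with n hn
    simp only [Function.comp]
    exact div_le_div₀ (hSn _) (hS (hu2 _ _ (hm1 n))) hn (hm2 n).le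
  · filter_upwards [hM.eventually_gt_atTop 0] with n hn
    have h1 : (0:ℝ) < (⌊√(E n)⌋₊ : ℕ) := by exact_mod_cast hn
    simp only [Function.comp]
    refine div_le_div₀ (hSn _) (hS ?_) (by positivity) (hm1 n)
    by_contra hcon
    push Not at hcon
    have := hE hcon.le
    have := hu1 (⌊√(E n)⌋₊ + 1)
    have := hm2 n
    linarith

lemma weak_lln {Ω : Type*} [MeasurableSpace Ω] (μ : Measure Ω) [IsProbabilityMeasure μ]
    (A : ℕ → Set Ω) (hA : ∀ j, MeasurableSet (A j)) (k : ℕ)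
    (hind : ∀ i j, i + k ≤ j → μ.real (A i ∩ A j) = μ.real (A i) * μ.real (A j)) (n : ℕ) :
    ∫⁻ x, ENNReal.ofReal ((∑ j ∈ Finset.range n, (A j).indicator (fun _ => (1:ℝ)) x
      - ∑ j ∈ Finset.range n, μ.real (A j))^2) ∂μ
      ≤ ENNReal.ofReal (2 * k * ∑ j ∈ Finset.range n, μ.real (A j)) := by
  have hexp : ∀ x, (∑ j ∈ Finset.range n, (A j).indicator (fun _ => (1:ℝ)) x
      - ∑ j ∈ Finset.range n, μ.real (A j))^2 = ∑ i ∈ Finset.range n, ∑ j ∈ Finset.range n,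
      ((A i ∩ A j).indicator (fun _ => (1:ℝ)) x - μ.real (A i) * (A j).indicator (fun _ => (1:ℝ)) x
       - μ.real (A j) * (A i).indicator (fun _ => (1:ℝ)) x + μ.real (A i) * μ.real (A j)) := by
    intro x
    rw [← Finset.sum_sub_distrib, sq, Finset.sum_mul_sum]
    refine Finset.sum_congr rfl fun i _ => Finset.sum_congr rfl fun j _ => ?_
    have : (A i ∩ A j).indicator (fun _ => (1:ℝ)) x
      = (A i).indicator (fun _ => (1:ℝ)) x * (A j).indicator (fun _ => (1:ℝ)) x := by
      rw [← Set.inter_indicator_mul]; simp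
    rw [this]; ring
  have hI : ∀ B : Set Ω, MeasurableSet B → Integrable (B.indicator (fun _ => (1:ℝ))) μ :=
    fun B hB => (integrable_const 1).indicator hB
  have hI1 : ∀ i j, Integrable (fun x => (A i ∩ A j).indicator (fun _ => (1:ℝ)) x
      - μ.real (A i) * (A j).indicator (fun _ => (1:ℝ)) x
       - μ.real (A j) * (A i).indicator (fun _ => (1:ℝ)) x + μ.real (A i) * μ.real (A j)) μ := by
    intro i j
    exact ((((hI _ ((hA i).inter (hA j))).sub ((hI _ (hA j)).const_mul _)).sub
      ((hI _ (hA i)).const_mul _)).add (integrable_const _))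
  have hint : ∀ i j, ∫ x, ((A i ∩ A j).indicator (fun _ => (1:ℝ)) x
      - μ.real (A i) * (A j).indicator (fun _ => (1:ℝ)) x
       - μ.real (A j) * (A i).indicator (fun _ => (1:ℝ)) x + μ.real (A i) * μ.real (A j)) ∂μ
       = μ.real (A i ∩ A j) - μ.real (A i) * μ.real (A j) := by
    intro i j
    have e : ∀ B : Set Ω, MeasurableSet B → ∫ x, B.indicator (fun _ => (1:ℝ)) x ∂μ = μ.real B := by
      intro B hB
      rw [integral_indicator hB]; simp
    have i1 := hI _ ((hA i).inter (hA j))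
    have i2 := (hI _ (hA j)).const_mul (μ.real (A i))
    have i3 := (hI _ (hA i)).const_mul (μ.real (A j))
    have i12 : Integrable (fun x => (A i ∩ A j).indicator (fun _ => (1:ℝ)) x
      - μ.real (A i) * (A j).indicator (fun _ => (1:ℝ)) x) μ := i1.sub i2
    have i123 : Integrable (fun x => (A i ∩ A j).indicator (fun _ => (1:ℝ)) x
      - μ.real (A i) * (A j).indicator (fun _ => (1:ℝ)) x
       - μ.real (A j) * (A i).indicator (fun _ => (1:ℝ)) x) μ := i12.sub i3
    rw [integral_add i123 (integrable_const _), integral_sub i12 i3,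
      integral_sub i1 i2, integral_const_mul, integral_const_mul, e _ (hA i), e _ (hA j),
      e _ ((hA i).inter (hA j))]
    simp
    ring
  simp_rw [hexp]
  rw [← ofReal_integral_eq_lintegral_ofReal]
  · apply ENNReal.ofReal_le_ofReal
    rw [integral_finsetSum _ (fun i _ => integrable_finsetSum _ (fun j _ => hI1 i j)),
      Finset.mul_sum]
    refine Finset.sum_le_sum fun i _ => ?_
    rw [integral_finsetSum _ (fun j _ => hI1 i j)]
    simp_rw [hint]
    have hb : ∀ j ∈ Finset.range n, μ.real (A i ∩ A j) - μ.real (A i) * μ.real (A j) ≤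
        if j ∈ Finset.Ico (i + 1 - k) (i + k) then μ.real (A i) else 0 := by
      intro j _
      split_ifs with hj
      · have h1 : μ.real (A i ∩ A j) ≤ μ.real (A i) := measureReal_mono Set.inter_subset_left
        have h2 : 0 ≤ μ.real (A i) * μ.real (A j) := by positivity
        linarith
      · rw [Finset.mem_Ico] at hj
        by_cases h : i + k ≤ j
        · rw [hind i j h]; simp
        · have h' : j + k ≤ i := by omega
          rw [Set.inter_comm, hind j i h', mul_comm]; simp
    refine (Finset.sum_le_sum hb).trans ?_
    rw [← Finset.sum_filter, Finset.sum_const, nsmul_eq_mul]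
    gcongr
    have : (Finset.filter (fun j => j ∈ Finset.Ico (i + 1 - k) (i + k)) (Finset.range n)).card
      ≤ (Finset.Ico (i + 1 - k) (i + k)).card :=
      Finset.card_le_card (fun j hj => (Finset.mem_filter.1 hj).2)
    rw [Nat.card_Ico] at this
    have h2 : (Finset.filter (fun j => j ∈ Finset.Ico (i + 1 - k) (i + k)) (Finset.range n)).card
      ≤ 2 * k := by omega
    exact_mod_cast h2
  · exact integrable_finsetSum _ (fun i _ => integrable_finsetSum _ (fun j _ => hI1 i j))
  · refine Filter.Eventually.of_forall fun x => ?_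
    rw [Pi.zero_apply]
    beta_reduce
    rw [← hexp]; positivity

lemma strong_lln {Ω : Type*} [MeasurableSpace Ω] (μ : Measure Ω) [IsProbabilityMeasure μ]
    (A : ℕ → Set Ω) (hA : ∀ j, MeasurableSet (A j)) (k : ℕ)
    (hind : ∀ i j, i + k ≤ j → μ.real (A i ∩ A j) = μ.real (A i) * μ.real (A j))
    (hdiv : Tendsto (fun n => ∑ j ∈ Finset.range n, μ.real (A j)) atTop atTop) :
    ∀ᵐ x ∂μ, Tendsto (fun n => (∑ j ∈ Finset.range n, (A j).indicator (fun _ => (1:ℝ)) x)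
      / ∑ j ∈ Finset.range n, μ.real (A j)) atTop (nhds 1) := by
  set E : ℕ → ℝ := fun n => ∑ j ∈ Finset.range n, μ.real (A j) with hEdef
  have hex : ∀ m : ℕ, ∃ n, (m:ℝ)^2 ≤ E n := fun m =>
    (hdiv.eventually_ge_atTop _).exists
  let u : ℕ → ℕ := fun m => Nat.find (hex m)
  have hu1 : ∀ m : ℕ, (m:ℝ)^2 ≤ E (u m) := fun m => Nat.find_spec (hex m)
  have hu2 : ∀ m n : ℕ, (m:ℝ)^2 ≤ E n → u m ≤ n := fun m n h => Nat.find_min' (hex m) h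
  let f : ℕ → Ω → ENNReal := fun m x => ENNReal.ofReal
    (((∑ j ∈ Finset.range (u (m+1)), (A j).indicator (fun _ => (1:ℝ)) x) / E (u (m+1)) - 1)^2)
  have hpos : ∀ m, 0 < E (u (m+1)) := fun m => lt_of_lt_of_le (by positivity) (hu1 (m+1))
  have hmeas : ∀ m, Measurable (f m) := by
    intro m
    refine ENNReal.measurable_ofReal.comp ?_
    refine Measurable.pow_const (Measurable.sub_const (Measurable.div_const ?_ _) _) _
    exact Finset.measurable_fun_sum _ (fun j _ => measurable_const.indicator (hA j))
  have hf : ∀ m, ∫⁻ x, f m x ∂μ ≤ ENNReal.ofReal (2 * k * (1 / ((m:ℝ)+1)^2)) := by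
    intro m
    have h1 := weak_lln μ A hA k hind (u (m+1))
    have h2 : ∀ x, f m x = ENNReal.ofReal (1 / E (u (m+1)) ^ 2) * ENNReal.ofReal
      ((∑ j ∈ Finset.range (u (m+1)), (A j).indicator (fun _ => (1:ℝ)) x - E (u (m+1)))^2) := by
      intro x
      rw [← ENNReal.ofReal_mul (by positivity)]
      simp only [f]
      congr 1
      have := (hpos m).ne'
      field_simp
    simp_rw [h2]
    rw [lintegral_const_mul' _ _ ENNReal.ofReal_ne_top]
    refine (mul_le_mul_right h1 _).trans ?_
    rw [← ENNReal.ofReal_mul (by positivity)]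
    apply ENNReal.ofReal_le_ofReal
    have h3 := hu1 (m+1)
    push_cast at h3
    have h4 := hpos m
    calc _ = 2 * k * (1 / E (u (m+1))) := by
          change 1 / E (u (m + 1)) ^ 2 * (2 * ↑k * E (u (m+1))) = _
          field_simp
      _ ≤ _ := by gcongr
  have hsum : Summable (fun m : ℕ => 2 * (k:ℝ) * (1 / ((m:ℝ)+1)^2)) := by
    apply Summable.mul_left
    have := (summable_nat_add_iff 1).2 (Real.summable_one_div_nat_pow.2 (one_lt_two))
    simpa using this
  have hfin : ∫⁻ x, ∑' m, f m x ∂μ ≠ ⊤ := by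
    rw [lintegral_tsum (fun m => (hmeas m).aemeasurable)]
    refine ne_top_of_le_ne_top ?_ (ENNReal.tsum_le_tsum hf)
    rw [← ENNReal.ofReal_tsum_of_nonneg (fun m => by positivity) hsum]
    exact ENNReal.ofReal_ne_top
  filter_upwards [ae_lt_top (Measurable.tsum hmeas) hfin] with x hx
  have ht := ENNReal.tendsto_atTop_zero_of_tsum_ne_top hx.ne
  have ht2 : Tendsto (fun m => ((∑ j ∈ Finset.range (u (m+1)),
      (A j).indicator (fun _ => (1:ℝ)) x) / E (u (m+1)) - 1)^2) atTop (nhds 0) := by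
    have := (ENNReal.tendsto_toReal ENNReal.zero_ne_top).comp ht
    refine (this.congr ?_)
    intro m
    simp only [Function.comp, f]
    rw [ENNReal.toReal_ofReal (by positivity)]
  have ht3 : Tendsto (fun m => (∑ j ∈ Finset.range (u (m+1)),
      (A j).indicator (fun _ => (1:ℝ)) x) / E (u (m+1))) atTop (nhds 1) := by
    have h5 := ht2.sqrt
    rw [Real.sqrt_zero] at h5
    simp_rw [Real.sqrt_sq_eq_abs] at h5
    have h6 := (tendsto_zero_iff_abs_tendsto_zero _).2 h5
    simpa using h6.add_const 1
  refine interp (fun n => ∑ j ∈ Finset.range n, (A j).indicator (fun _ => (1:ℝ)) x) E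
    ?_ ?_ (by simp) (by simp [E]) ?_ u hu1 hu2 hdiv ?_
  · refine monotone_nat_of_le_succ fun n => ?_
    rw [Finset.sum_range_succ]
    have : 0 ≤ (A n).indicator (fun _ => (1:ℝ)) x := Set.indicator_nonneg (fun _ _ => zero_le_one) _
    linarith
  · refine monotone_nat_of_le_succ fun n => ?_
    simp only [E]
    rw [Finset.sum_range_succ]
    have : 0 ≤ μ.real (A n) := measureReal_nonneg
    linarith
  · intro n
    simp only [E]
    rw [Finset.sum_range_succ]
    gcongr
    exact measureReal_le_one
  · exact (tendsto_add_atTop_iff_nat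
      (f := fun m => (∑ j ∈ Finset.range (u m), (A j).indicator (fun _ => (1:ℝ)) x) / E (u m)) 1).1 ht3

/-- The event that the block `B` occurs at position `j`. -/
def ev (q : ℕ → ℕ) (k : ℕ) (B : Fin k → ℕ) (j : ℕ) : Set ℝ :=
  {x | ∀ i : Fin k, cdig q (j + i) x = B i}

/-- The block `B` placed at position `j`, as a digit constraint. -/
def gB (k : ℕ) (B : Fin k → ℕ) (j n : ℕ) : ℕ := if h : n - j < k then B ⟨n - j, h⟩ else 0

lemma gB_add (k : ℕ) (B : Fin k → ℕ) (j : ℕ) (i : Fin k) : gB k B j (j + i) = B i := by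
  have : j + (i:ℕ) - j = i := by omega
  simp [gB, this]

lemma mem_ev_iff (q : ℕ → ℕ) (k : ℕ) (B : Fin k → ℕ) (j : ℕ) (x : ℝ) :
    x ∈ ev q k B j ↔ ∀ n ∈ Finset.Ico j (j+k), cdig q n x = gB k B j n := by
  constructor
  · intro h n hn
    rw [Finset.mem_Ico] at hn
    have := h ⟨n - j, by omega⟩
    have e : j + (n - j) = n := by omega
    simp only [e] at this
    rw [this, gB, dif_pos (by omega)]
  · intro h i
    rw [h (j+i) (by rw [Finset.mem_Ico]; omega), gB_add]

lemma ev_measurable (q : ℕ → ℕ) (k : ℕ) (B : Fin k → ℕ) (j : ℕ) : MeasurableSet (ev q k B j) := by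
  have : ev q k B j = ⋂ i : Fin k, cdig q (j+i) ⁻¹' {B i} := by
    ext x; simp [ev]
  rw [this]
  exact MeasurableSet.iInter fun i => measurable_cdig q _ (measurableSet_singleton _)

lemma ev_prob' (q : ℕ → ℕ) (hq : ∀ n, 2 ≤ q n) (m : ℤ) (k : ℕ) (B : Fin k → ℕ) (j : ℕ) :
    (unitM m).real (ev q k B j)
      = ∏ n ∈ Finset.Ico j (j+k), (if gB k B j n < q n then 1 / (q n : ℝ) else 0) := by
  rw [← unitM_digits q hq m]
  congr 1
  ext x
  exact mem_ev_iff q k B j x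

lemma ev_prob_eq (q : ℕ → ℕ) (hq : ∀ n, 2 ≤ q n) (m : ℤ) (k : ℕ) (B : Fin k → ℕ) (j : ℕ)
    (h : ∀ i : Fin k, B i < q (j + i)) :
    (unitM m).real (ev q k B j) = 1 / ∏ i ∈ Finset.range k, (q (j + i) : ℝ) := by
  rw [ev_prob' q hq, Finset.prod_Ico_eq_prod_range, one_div, ← Finset.prod_inv_distrib,
    Nat.add_sub_cancel_left]
  refine Finset.prod_congr rfl fun i hi => ?_
  have hi' := Finset.mem_range.1 hi
  have := gB_add k B j ⟨i, hi'⟩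
  simp only at this
  rw [this, if_pos (h ⟨i, hi'⟩), one_div]

lemma ev_prob_zero (q : ℕ → ℕ) (hq : ∀ n, 2 ≤ q n) (m : ℤ) (k : ℕ) (B : Fin k → ℕ) (j : ℕ)
    (h : ∃ i : Fin k, q (j + i) ≤ B i) :
    (unitM m).real (ev q k B j) = 0 := by
  obtain ⟨i, hi⟩ := h
  rw [ev_prob' q hq]
  refine Finset.prod_eq_zero (i := j + i) (by rw [Finset.mem_Ico]; omega) ?_
  rw [gB_add, if_neg (by omega)]

lemma ev_indep (q : ℕ → ℕ) (hq : ∀ n, 2 ≤ q n) (m : ℤ) (k : ℕ) (B : Fin k → ℕ) (i j : ℕ)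
    (hij : i + k ≤ j) : (unitM m).real (ev q k B i ∩ ev q k B j)
      = (unitM m).real (ev q k B i) * (unitM m).real (ev q k B j) := by
  have hset : ev q k B i ∩ ev q k B j = {x | ∀ n ∈ Finset.Ico i (i+k) ∪ Finset.Ico j (j+k),
      cdig q n x = if n < i + k then gB k B i n else gB k B j n} := by
    ext x
    rw [Set.mem_inter_iff, mem_ev_iff, mem_ev_iff]
    simp only [Set.mem_ofPred_eq, Finset.mem_union, Finset.mem_Ico]
    constructor
    · rintro ⟨h1, h2⟩ n hn
      split_ifs with h
      · exact h1 n (by omega)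
      · exact h2 n (by omega)
    · intro h
      refine ⟨fun n hn => ?_, fun n hn => ?_⟩
      · have := h n (by omega)
        rwa [if_pos (by omega)] at this
      · have := h n (by omega)
        rwa [if_neg (by omega)] at this
  have hd : Disjoint (Finset.Ico i (i+k)) (Finset.Ico j (j+k)) := by
    rw [Finset.disjoint_left]
    intro n h1 h2
    rw [Finset.mem_Ico] at h1 h2
    omega
  rw [hset, unitM_digits q hq, Finset.prod_union hd, ev_prob' q hq, ev_prob' q hq]
  congr 1
  · refine Finset.prod_congr rfl fun n hn => ?_
    rw [Finset.mem_Ico] at hn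
    rw [if_pos hn.2]
  · refine Finset.prod_congr rfl fun n hn => ?_
    rw [Finset.mem_Ico] at hn
    rw [if_neg (show ¬ n < i + k by omega)]

lemma ae_of_unitM (p : ℝ → Prop) (h : ∀ m : ℤ, ∀ᵐ x ∂(unitM m), p x) : ∀ᵐ x : ℝ, p x := by
  have h1 : ∀ m : ℤ, ∀ᵐ x : ℝ, x ∈ Set.Ico (m:ℝ) (m+1) → p x := fun m =>
    (ae_restrict_iff' measurableSet_Ico).1 (h m)
  filter_upwards [ae_all_iff.2 h1] with x hx
  exact hx ⌊x⌋ ⟨Int.floor_le x, Int.lt_floor_add_one x⟩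

/-- The weight of position `j`. -/
def wt (q : ℕ → ℕ) (k j : ℕ) : ℝ := 1 / ∏ i ∈ Finset.range k, (q (j + i) : ℝ)

lemma wt_nonneg (q : ℕ → ℕ) (k j : ℕ) : 0 ≤ wt q k j :=
  div_nonneg zero_le_one (Finset.prod_nonneg fun i _ => Nat.cast_nonneg _)

lemma wt_le_one (q : ℕ → ℕ) (hq : ∀ n, 2 ≤ q n) (k j : ℕ) : wt q k j ≤ 1 := by
  have : (1:ℝ) ≤ ∏ i ∈ Finset.range k, (q (j + i) : ℝ) := by
    have := Finset.prod_le_prod (s := Finset.range k) (f := fun _ => (1:ℝ))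
      (g := fun i => (q (j + i) : ℝ)) (fun _ _ => zero_le_one)
      (fun i _ => by have := hq (j+i); exact_mod_cast (by omega : 1 ≤ q (j+i)))
    simpa using this
  exact div_le_one_of_le₀ this (zero_le_one.trans this)

lemma blockCount_eq (q : ℕ → ℕ) (k : ℕ) (B : Fin k → ℕ) (x : ℝ) (n : ℕ) :
    (blockCount (fun n => cdig q n x) k B n : ℝ)
      = ∑ j ∈ Finset.range (n + 1 - k), (ev q k B j).indicator (fun _ => (1:ℝ)) x := by
  unfold blockCount
  rw [Finset.card_filter]
  push_cast
  refine Finset.sum_congr rfl fun j _ => ?_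
  rw [Set.indicator_apply]
  exact if_congr Iff.rfl rfl rfl

lemma bounded_ratio (f g : ℕ → ℝ) (C : ℝ) (hb : ∀ n, |f n - g n| ≤ C)
    (hg : Tendsto g atTop atTop) : Tendsto (fun n => f n / g n) atTop (nhds 1) := by
  have h1 : Tendsto (fun n => C / g n) atTop (nhds 0) := hg.const_div_atTop C
  have h2 : Tendsto (fun n => (f n - g n) / g n) atTop (nhds 0) := by
    refine squeeze_zero_norm' ?_ h1
    filter_upwards [hg.eventually_gt_atTop 0] with n hn
    rw [norm_div, Real.norm_eq_abs, Real.norm_eq_abs, abs_of_pos hn]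
    have := hb n
    gcongr
  have h3 := h2.add_const 1
  rw [zero_add] at h3
  refine h3.congr' ?_
  filter_upwards [hg.eventually_gt_atTop 0] with n hn
  field_simp
  ring

lemma div_part (q : ℕ → ℕ) (hq : ∀ n, 2 ≤ q n)
    (hlim : Tendsto q atTop atTop) (k : ℕ) (hdiv : Tendsto (fun n => Qnk q k n) atTop atTop)
    (m : ℤ) (B : Fin k → ℕ) : ∀ᵐ x ∂(unitM m),
    Tendsto (fun n => (blockCount (fun n => cdig q n x) k B n : ℝ) / Qnk q k n)
      atTop (nhds 1) := by
  set P : ℕ → ℝ := fun j => (unitM m).real (ev q k B j) with hP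
  have hev : ∀ᶠ j in atTop, ∀ i : Fin k, B i < q (j + i) := by
    rw [eventually_all]
    intro i
    exact (hlim.comp (tendsto_add_atTop_nat i)).eventually_gt_atTop (B i)
  obtain ⟨J, hJ⟩ := eventually_atTop.1 hev
  have hPw : ∀ j, J ≤ j → P j = wt q k j := fun j hj => ev_prob_eq q hq m k B j (hJ j hj)
  have hdiff : ∀ n, |∑ j ∈ Finset.range n, P j - Qnk q k n| ≤ J := by
    intro n
    change |∑ j ∈ Finset.range n, P j - ∑ j ∈ Finset.range n, wt q k j| ≤ J
    rw [← Finset.sum_sub_distrib]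
    calc |∑ j ∈ Finset.range n, (P j - wt q k j)|
        ≤ ∑ j ∈ Finset.range n, |P j - wt q k j| := Finset.abs_sum_le_sum_abs _ _
      _ ≤ ∑ j ∈ Finset.range n, (if j ∈ Finset.range J then 1 else 0) := by
          refine Finset.sum_le_sum fun j _ => ?_
          split_ifs with h
          · have h1 : 0 ≤ P j := measureReal_nonneg
            have h2 : P j ≤ 1 := measureReal_le_one
            have h3 := wt_nonneg q k j
            have h4 := wt_le_one q hq k j
            rw [abs_le]; constructor <;> linarith
          · rw [hPw j (by simpa using h)]; simp
      _ ≤ J := by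
          rw [← Finset.sum_filter, Finset.sum_const, nsmul_eq_mul, mul_one]
          have : (Finset.filter (fun j => j ∈ Finset.range J) (Finset.range n)).card
            ≤ (Finset.range J).card :=
            Finset.card_le_card (fun j hj => (Finset.mem_filter.1 hj).2)
          rw [Finset.card_range] at this
          exact_mod_cast this
  have hPdiv : Tendsto (fun n => ∑ j ∈ Finset.range n, P j) atTop atTop := by
    refine tendsto_atTop_mono (fun n => ?_) (tendsto_atTop_add_const_right _ (-(J:ℝ)) hdiv)
    have := abs_le.1 (hdiff n)
    linarith [this.1]
  have hsub : Tendsto (fun n : ℕ => n + 1 - k) atTop atTop := by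
    refine tendsto_atTop_atTop.2 fun b => ⟨b + k, fun n hn => by omega⟩
  have hQ : ∀ n, |∑ j ∈ Finset.range (n+1-k), P j - Qnk q k n| ≤ J + (k + 1) := by
    intro n
    have h1 := hdiff (n+1-k)
    have h2 : |Qnk q k (n+1-k) - Qnk q k n| ≤ k + 1 := by
      rcases le_total n (n+1-k) with h | h
      · have hk : n + 1 - k = n ∨ n + 1 - k = n + 1 := by omega
        rcases hk with hk | hk
        · rw [hk]; simp; positivity
        · rw [hk]
          have : Qnk q k (n+1) = Qnk q k n + wt q k n := by
            simp [Qnk, wt, Finset.sum_range_succ]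
          rw [this, add_sub_cancel_left, abs_of_nonneg (wt_nonneg _ _ _)]
          have := wt_le_one q hq k n
          have : (0:ℝ) ≤ k := by positivity
          linarith
      · have e : Qnk q k n - Qnk q k (n+1-k) = ∑ j ∈ Finset.Ico (n+1-k) n, wt q k j := by
          rw [Finset.sum_Ico_eq_sub _ h]; rfl
        rw [abs_sub_comm, e, abs_of_nonneg (Finset.sum_nonneg fun j _ => wt_nonneg _ _ _)]
        calc _ ≤ ∑ j ∈ Finset.Ico (n+1-k) n, (1:ℝ) :=
              Finset.sum_le_sum fun j _ => wt_le_one q hq k j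
          _ ≤ k + 1 := by
              rw [Finset.sum_const, Nat.card_Ico, nsmul_eq_mul, mul_one]
              have : n - (n+1-k) ≤ k + 1 := by omega
              exact_mod_cast this
    have := abs_sub_le (∑ j ∈ Finset.range (n+1-k), P j) (Qnk q k (n+1-k)) (Qnk q k n)
    linarith
  have hrat := bounded_ratio _ _ _ hQ hdiv
  have hslln := strong_lln (unitM m) (ev q k B) (ev_measurable q k B) k
    (fun i j => ev_indep q hq m k B i j) hPdiv
  filter_upwards [hslln] with x hx
  have h1 := (hx.comp hsub).mul hrat
  rw [one_mul] at h1
  refine h1.congr' ?_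
  filter_upwards [(hPdiv.comp hsub).eventually_gt_atTop 0, hdiv.eventually_gt_atTop 0] with n h2 h3
  rw [blockCount_eq]
  simp only [Function.comp] at h2 ⊢
  change _ / (∑ j ∈ Finset.range (n + 1 - k), P j) * _ = _
  field_simp

lemma conv_part (q : ℕ → ℕ) (hq : ∀ n, 2 ≤ q n)
    (k : ℕ) (hk : 1 ≤ k) (hdiv : ¬ Tendsto (fun n => Qnk q k n) atTop atTop)
    (m : ℤ) : ∀ᵐ x ∂(unitM m), ¬ QNormalOrder q k x := by
  have hsum : Summable (wt q k) := by
    by_contra hcon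
    exact hdiv ((not_summable_iff_tendsto_nat_atTop_of_nonneg (wt_nonneg q k)).1 hcon)
  let U : ℕ → Set ℝ := fun b => ⋃ j, ev q k (fun _ => b) j
  have hsub : ∀ b, {x | QNormalOrder q k x} ⊆ U b := by
    rintro b x ⟨E, hE, hB⟩
    have hEq : E = fun n => cdig q n x := funext fun n => isCantorExp_unique q hq x E hE n
    have h1 := Filter.Tendsto.eventually_const_lt zero_lt_one (hB (fun _ => b))
    obtain ⟨n, hn⟩ := h1.exists
    have h2 : blockCount E k (fun _ => b) n ≠ 0 := by
      intro h0; rw [h0] at hn; simp at hn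
    obtain ⟨j, hj⟩ := Finset.card_ne_zero.1 h2
    rw [Finset.mem_filter] at hj
    refine Set.mem_iUnion.2 ⟨j, fun i => ?_⟩
    have := hj.2 i
    rw [hEq] at this
    exact this
  have hbound : ∀ J : ℕ, ∃ b, unitM m (U b) ≤ ENNReal.ofReal (∑' j, wt q k (j + J)) := by
    intro J
    refine ⟨∑ j ∈ Finset.range J, q j, ?_⟩
    set b := ∑ j ∈ Finset.range J, q j with hb
    have hzero : ∀ j < J, (unitM m) (ev q k (fun _ => b) j) = 0 := by
      intro j hj
      have h := ev_prob_zero q hq m k (fun _ => b) j ⟨⟨0, hk⟩, by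
        simp only [add_zero]
        exact Finset.single_le_sum (f := q) (fun _ _ => Nat.zero_le _) (Finset.mem_range.2 hj)⟩
      exact (measureReal_eq_zero_iff).1 h
    have hle : ∀ j, (unitM m) (ev q k (fun _ => b) j) ≤ ENNReal.ofReal (wt q k j) := by
      intro j
      rw [← ofReal_measureReal]
      apply ENNReal.ofReal_le_ofReal
      by_cases h : ∃ i : Fin k, q (j + i) ≤ b
      · rw [ev_prob_zero q hq m k _ j h]; exact wt_nonneg _ _ _
      · push Not at h
        rw [ev_prob_eq q hq m k _ j h]; rfl
    calc unitM m (U b) ≤ ∑' j, unitM m (ev q k (fun _ => b) j) := measure_iUnion_le _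
      _ = ∑ j ∈ Finset.range J, unitM m (ev q k (fun _ => b) j)
          + ∑' j, unitM m (ev q k (fun _ => b) (j+J)) :=
          (ENNReal.summable.sum_add_tsum_nat_add' (f := fun j => unitM m (ev q k (fun _ => b) j))).symm
      _ = ∑' j, unitM m (ev q k (fun _ => b) (j+J)) := by
          rw [Finset.sum_eq_zero (fun j hj => hzero j (Finset.mem_range.1 hj)), zero_add]
      _ ≤ ∑' j, ENNReal.ofReal (wt q k (j+J)) := ENNReal.tsum_le_tsum fun j => hle _
      _ = _ := (ENNReal.ofReal_tsum_of_nonneg (fun j => wt_nonneg _ _ _)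
          ((summable_nat_add_iff J).2 hsum)).symm
  have ht : Tendsto (fun J => ENNReal.ofReal (∑' j, wt q k (j + J))) atTop (nhds 0) := by
    have := ENNReal.tendsto_ofReal (tendsto_sum_nat_add (wt q k))
    rwa [ENNReal.ofReal_zero] at this
  rw [ae_iff]
  simp only [not_not]
  refine le_antisymm (ge_of_tendsto' ht fun J => ?_) zero_le
  obtain ⟨b, hb⟩ := hbound J
  exact (measure_mono (hsub b)).trans hb

/-- If `q n → ∞`, then `N_k(Q)` has full measure when `Q` is `k`-divergent and
measure zero in every bounded interval when `Q` is `k`-convergent. -/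
theorem normalOrder_measure (q : ℕ → ℕ) (hq : ∀ n, 2 ≤ q n)
    (hlim : Tendsto q atTop atTop) (k : ℕ) (hk : 1 ≤ k) :
    (Tendsto (fun n => Qnk q k n) atTop atTop →
      ∀ᵐ x : ℝ, QNormalOrder q k x) ∧
    (¬ Tendsto (fun n => Qnk q k n) atTop atTop →
      ∀ a b : ℝ, volume ({x : ℝ | QNormalOrder q k x} ∩ Set.Icc a b) = 0) := by
  refine ⟨fun hdiv => ?_, fun hdiv a b => ?_⟩
  · refine ae_of_unitM _ fun m => ?_
    filter_upwards [ae_all_iff.2 (fun B : Fin k → ℕ => div_part q hq hlim k hdiv m B)] with x hx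
    exact ⟨_, isCantorExp_cdig q hq x, hx⟩
  · have h := ae_of_unitM _ (conv_part q hq k hk hdiv)
    rw [ae_iff] at h
    simp only [not_not] at h
    exact measure_mono_null Set.inter_subset_left h
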